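/- arXiv:2009.02415 — 10 statements merged into one kernel-verified Lean document; each statement's English description precedes it below -/
import Mathlib

section
/- For all natural numbers n, r, s, t, u such that n is even, the numbers r, s, u all have the same parity, n ≤ r + u, n ≤ s + u, n ≤ 2*u, and n ≤ 2*t + r + s, one has n*n ≤ r*(r-1) + s*(s-1) + 2*u*(t + s + r). -/
/-- A factor-by-factor lower bound for `r * (r - 1 + u)` in terms of a lower bound on `r + u`. -/
theorem sub_mul_pred_le_of_le_add {n r u : ℤ} (hn : 1 ≤ n) (hu : u ≤ n) (h : n ≤ r + u) :
    (n - u) * (n - 1) ≤ r * (r - 1) + u * r := by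
  have := mul_le_mul (show n - u ≤ r by linarith) (show n - 1 ≤ r + u - 1 by linarith)
    (by linarith) (by linarith)
  linarith

/-- Arithmetic core of the optimal discrete systolic inequality for the Klein
bottle: if `n` is even, `r`, `s`, `u` all have the same parity, and
`n ≤ r + u`, `n ≤ s + u`, `n ≤ 2*u`, `n ≤ 2*t + r + s`, then
`n*n ≤ r*(r-1) + s*(s-1) + 2*u*(t + s + r)`. -/
theorem discrete_systolic_klein_arith (n r s t u : ℕ)
    (hn : Even n) (hrs : r % 2 = s % 2) (hru : r % 2 = u % 2)
    (h1 : n ≤ r + u) (h2 : n ≤ s + u) (h3 : n ≤ 2 * u)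
    (h4 : n ≤ 2 * t + r + s) :
    n * n ≤ r * (r - 1) + s * (s - 1) + 2 * u * (t + s + r) := by
  rcases Nat.eq_zero_or_pos n with rfl | hpos
  · simp
  have hn2 : 2 ≤ n := by
    obtain ⟨m, rfl⟩ := hn
    omega
  rcases le_total n u with hu | hu
  · calc n * n ≤ u * (2 * t + r + s) := Nat.mul_le_mul hu h4
      _ ≤ 2 * u * (t + s + r) := by
        rw [mul_comm 2 u, mul_assoc]
        exact Nat.mul_le_mul_left u (by omega)
      _ ≤ _ := Nat.le_add_left _ _
  · have cast_mul_pred (k : ℕ) : ((k * (k - 1) : ℕ) : ℤ) = k * (k - 1) := by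
      cases k <;> simp
    zify at hn2 hu h1 h2 h4
    rw [← Int.ofNat_le]
    rw [Nat.cast_add, Nat.cast_add, cast_mul_pred, cast_mul_pred]
    push_cast
    have hr := sub_mul_pred_le_of_le_add (by linarith) hu h1
    have hs := sub_mul_pred_le_of_le_add (by linarith) hu h2
    have ht := mul_le_mul_of_nonneg_left h4 (Int.natCast_nonneg u)
    have hnu := mul_nonneg (sub_nonneg.2 hu) (sub_nonneg.2 hn2)
    linarith
end

section
/- A bijection g of ℝ × ℝ belongs to Γ if and only if either there exist integers t, u such that g(x,y) = (x + 2t, y + u) for all (x,y) ∈ ℝ × ℝ, or there exist integers c, d with c odd such that g(x,y) = (x + c, d − y) for all (x,y) ∈ ℝ × ℝ. -/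
/-- The unit vertical translation `U(x,y) = (x, y+1)`. -/
def Umap : Equiv.Perm (ℝ × ℝ) where
  toFun p := (p.1, p.2 + 1)
  invFun p := (p.1, p.2 - 1)
  left_inv p := by simp
  right_inv p := by simp

/-- The unit glide-reflection `R(x,y) = (x+1, -y)` along the line `y = 0`. -/
def Rmap : Equiv.Perm (ℝ × ℝ) where
  toFun p := (p.1 + 1, -p.2)
  invFun p := (p.1 - 1, -p.2)
  left_inv p := by simp
  right_inv p := by simp

/-- The deck transformation group of the Klein bottle, generated by `U` and `R`. -/
def kleinGroup : Subgroup (Equiv.Perm (ℝ × ℝ)) := Subgroup.closure {Umap, Rmap}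

/-- Integer powers of a permutation translating by `v` translate by multiples of `v`. -/
theorem Equiv.Perm.zpow_apply_eq_add_zsmul {A : Type*} [AddCommGroup A] {f : Equiv.Perm A} {v : A}
    (hf : ∀ p, f p = p + v) (n : ℤ) (p : A) : (f ^ n) p = p + n • v := by
  have h : f = Equiv.addRight v := Equiv.ext hf
  rw [h, Equiv.zsmul_addRight, Equiv.coe_addRight]

theorem Umap_zpow_apply (n : ℤ) (p : ℝ × ℝ) : (Umap ^ n) p = (p.1, p.2 + n) := by
  rw [Equiv.Perm.zpow_apply_eq_add_zsmul (v := (0, 1)) (fun p => by ext <;> simp [Umap])]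
  ext <;> simp

theorem Rmap_sq_zpow_apply (n : ℤ) (p : ℝ × ℝ) :
    ((Rmap ^ 2) ^ n) p = (p.1 + 2 * n, p.2) := by
  rw [Equiv.Perm.zpow_apply_eq_add_zsmul (v := (2, 0))
    (fun p => by ext <;> simp [Rmap, sq, add_assoc, one_add_one_eq_two])]
  ext <;> simp [mul_comm]

/-- A bijection `g` of `ℝ × ℝ` belongs to `Γ = ⟨U, R⟩` if and only if it is
either a translation `(x,y) ↦ (x + 2t, y + u)` with `t, u ∈ ℤ`, or a
glide-reflection `(x,y) ↦ (x + c, d - y)` with `c, d ∈ ℤ` and `c` odd. -/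
theorem mem_kleinGroup_iff (g : Equiv.Perm (ℝ × ℝ)) :
    g ∈ kleinGroup ↔
      ((∃ t u : ℤ, ∀ p : ℝ × ℝ, g p = (p.1 + 2 * t, p.2 + u)) ∨
       (∃ c d : ℤ, Odd c ∧ ∀ p : ℝ × ℝ, g p = (p.1 + c, d - p.2))) := by
  constructor
  · intro hg
    induction hg using Subgroup.closure_induction with
    | mem x hx =>
      rcases hx with rfl | rfl
      · exact Or.inl ⟨0, 1, fun p => by simp [Umap]⟩
      · exact Or.inr ⟨1, 0, odd_one, fun p => by simp [Rmap]⟩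
    | one => exact Or.inl ⟨0, 0, fun p => by simp⟩
    | mul x y _ _ hx hy =>
      rcases hx with ⟨t, u, hx⟩ | ⟨c, d, hc, hx⟩ <;> rcases hy with ⟨s, v, hy⟩ | ⟨b, e, hb, hy⟩
      · refine Or.inl ⟨t + s, u + v, fun p => ?_⟩
        rw [Equiv.Perm.mul_apply, hy, hx]
        ext <;> push_cast <;> ring
      · refine Or.inr ⟨2 * t + b, u + e, (even_two_mul t).add_odd hb, fun p => ?_⟩
        rw [Equiv.Perm.mul_apply, hy, hx]
        ext <;> push_cast <;> ring
      · refine Or.inr ⟨c + 2 * s, d - v, hc.add_even (even_two_mul s), fun p => ?_⟩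
        rw [Equiv.Perm.mul_apply, hy, hx]
        ext <;> push_cast <;> ring
      · obtain ⟨k, hk⟩ := (hc.add_odd hb).two_dvd
        have hk' : (c : ℝ) + b = 2 * k := by exact_mod_cast hk
        refine Or.inl ⟨k, d - e, fun p => ?_⟩
        rw [Equiv.Perm.mul_apply, hy, hx, ← hk']
        ext <;> push_cast <;> ring
    | inv x _ hx =>
      rcases hx with ⟨t, u, hx⟩ | ⟨c, d, hc, hx⟩
      · refine Or.inl ⟨-t, -u, fun p => ?_⟩
        rw [Equiv.Perm.inv_eq_iff_eq, hx]
        ext <;> push_cast <;> ring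
      · refine Or.inr ⟨-c, d, hc.neg, fun p => ?_⟩
        rw [Equiv.Perm.inv_eq_iff_eq, hx]
        ext <;> push_cast <;> ring
  · have hU : Umap ∈ kleinGroup := Subgroup.subset_closure (by simp)
    have hR : Rmap ∈ kleinGroup := Subgroup.subset_closure (by simp)
    rintro (⟨t, u, hg⟩ | ⟨c, d, ⟨k, rfl⟩, hg⟩)
    · have h : g = Umap ^ u * (Rmap ^ 2) ^ t := by
        ext1 p
        rw [hg, Equiv.Perm.mul_apply, Rmap_sq_zpow_apply, Umap_zpow_apply]
      rw [h]
      exact mul_mem (zpow_mem hU u) (zpow_mem (pow_mem hR 2) t)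
    · have h : g = Umap ^ d * ((Rmap ^ 2) ^ k * Rmap) := by
        ext1 p
        rw [hg, Equiv.Perm.mul_apply, Equiv.Perm.mul_apply, Rmap_sq_zpow_apply, Umap_zpow_apply]
        ext <;> simp [Rmap] <;> ring
      rw [h]
      exact mul_mem (zpow_mem hU d) (mul_mem (zpow_mem (pow_mem hR 2) k) hR)
end

section
/- Define T := R ∘ R and S := U ∘ R in Γ (so T(x,y) = (x+2, y) and S(x,y) = (x+1, 1−y)). For every g ∈ Γ there is exactly one element h of the set {T^t ∘ U^u : t, u ∈ ℕ} ∪ {R^(2k+1) : k ∈ ℕ} ∪ {S^(2k+1) : k ∈ ℕ} such that g is conjugate in Γ to h or to h⁻¹. -/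
/-- The horizontal translation `T = R ∘ R`, `T(x,y) = (x+2, y)`. -/
def Tmap : Equiv.Perm (ℝ × ℝ) := Rmap * Rmap

/-- The glide-reflection `S = U ∘ R`, `S(x,y) = (x+1, 1-y)`, along `y = 1/2`. -/
def Smap : Equiv.Perm (ℝ × ℝ) := Umap * Rmap

/-- The set of normal forms: translations `T^t * U^u` with `t, u ∈ ℕ` and odd
glide-reflections `R^(2k+1)`, `S^(2k+1)` with `k ∈ ℕ`. -/
def kleinNormalForms : Set (Equiv.Perm (ℝ × ℝ)) :=
  {h | ∃ t u : ℕ, h = Tmap ^ t * Umap ^ u} ∪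
    {h | ∃ k : ℕ, h = Rmap ^ (2 * k + 1)} ∪
    {h | ∃ k : ℕ, h = Smap ^ (2 * k + 1)}

/-- The sign `(-1) ^ n` of an integer, as an integer. -/
def kleinSign (n : ℤ) : ℤ := n.negOnePow

lemma kleinSign_add (m n : ℤ) : kleinSign (m + n) = kleinSign m * kleinSign n := by
  simp [kleinSign, Int.negOnePow_add]

lemma kleinSign_even {n : ℤ} (hn : Even n) : kleinSign n = 1 := by
  simp [kleinSign, Int.negOnePow_even n hn]

lemma kleinSign_odd {n : ℤ} (hn : Odd n) : kleinSign n = -1 := by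
  simp [kleinSign, Int.negOnePow_odd n hn]

lemma kleinSign_neg (n : ℤ) : kleinSign (-n) = kleinSign n := by
  simp [kleinSign]

lemma kleinSign_mul_self (n : ℤ) : kleinSign n * kleinSign n = 1 := by
  rcases Int.even_or_odd n with h | h <;> simp [kleinSign_even, kleinSign_odd, h]

/-- The isometry `(x, y) ↦ (x + n, (-1) ^ n * y + m)`, which is `U ^ m * R ^ n`. -/
def kleinElt (n m : ℤ) : Equiv.Perm (ℝ × ℝ) where
  toFun p := (p.1 + n, kleinSign n * p.2 + m)
  invFun p := (p.1 - n, kleinSign n * (p.2 - m))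
  left_inv p := by
    have h : (kleinSign n : ℝ) * kleinSign n = 1 := by exact_mod_cast kleinSign_mul_self n
    ext
    · simp
    · simp [← mul_assoc, h]
  right_inv p := by
    have h : (kleinSign n : ℝ) * kleinSign n = 1 := by exact_mod_cast kleinSign_mul_self n
    ext
    · simp
    · simp [← mul_assoc, h]

lemma kleinElt_apply (n m : ℤ) (p : ℝ × ℝ) :
    kleinElt n m p = (p.1 + n, kleinSign n * p.2 + m) := rfl

lemma kleinElt_mul (n m n' m' : ℤ) :
    kleinElt n m * kleinElt n' m' = kleinElt (n + n') (m + kleinSign n * m') := by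
  ext p
  · simp only [Equiv.Perm.mul_apply, kleinElt_apply]
    push_cast
    ring
  · simp only [Equiv.Perm.mul_apply, kleinElt_apply, kleinSign_add]
    push_cast
    ring

lemma kleinElt_zero : kleinElt 0 0 = 1 := by
  ext p <;> simp [kleinElt_apply, kleinSign]

lemma kleinElt_inv (n m : ℤ) : (kleinElt n m)⁻¹ = kleinElt (-n) (-(kleinSign n * m)) := by
  rw [inv_eq_iff_mul_eq_one, kleinElt_mul, ← kleinElt_zero]
  congr 1
  · ring
  · linear_combination (-m) * kleinSign_mul_self n

lemma kleinElt_inj {n m n' m' : ℤ} : kleinElt n m = kleinElt n' m' ↔ n = n' ∧ m = m' := by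
  refine ⟨fun h => ?_, by rintro ⟨rfl, rfl⟩; rfl⟩
  simpa [kleinElt_apply] using congrArg (· (0, 0)) h

lemma kleinElt_conj (a b n m : ℤ) :
    kleinElt a b * kleinElt n m * (kleinElt a b)⁻¹ =
      kleinElt n (b + kleinSign a * m - kleinSign n * b) := by
  rw [mul_inv_eq_iff_eq_mul, kleinElt_mul, kleinElt_mul, add_comm a n]
  congr 1
  ring

lemma Umap_eq : Umap = kleinElt 0 1 := by
  ext p <;> simp [kleinElt_apply, kleinSign, Umap]

lemma Rmap_eq : Rmap = kleinElt 1 0 := by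
  ext p <;> simp [kleinElt_apply, kleinSign, Rmap]

lemma Tmap_eq : Tmap = kleinElt 2 0 := by
  rw [Tmap, Rmap_eq, kleinElt_mul]
  norm_num

lemma Smap_eq : Smap = kleinElt 1 1 := by
  rw [Smap, Umap_eq, Rmap_eq, kleinElt_mul]
  norm_num

lemma Umap_zpow (m : ℤ) : Umap ^ m = kleinElt 0 m := by
  induction m using Int.induction_on with
  | zero => exact kleinElt_zero.symm
  | succ k ih =>
    rw [zpow_add_one, ih, Umap_eq, kleinElt_mul, kleinSign_even Even.zero]
    simp
  | pred k ih =>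
    rw [zpow_sub_one, ih, Umap_eq, kleinElt_inv, kleinElt_mul, kleinSign_even Even.zero]
    simp [sub_eq_add_neg]

lemma Rmap_zpow (n : ℤ) : Rmap ^ n = kleinElt n 0 := by
  induction n using Int.induction_on with
  | zero => exact kleinElt_zero.symm
  | succ k ih =>
    rw [zpow_add_one, ih, Rmap_eq, kleinElt_mul]
    simp
  | pred k ih =>
    rw [zpow_sub_one, ih, Rmap_eq, kleinElt_inv, kleinElt_mul]
    simp [sub_eq_add_neg]

lemma Tmap_pow_mul_Umap_pow (t u : ℕ) : Tmap ^ t * Umap ^ u = kleinElt (2 * t) u := by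
  have hT : Tmap ^ t = Rmap ^ (2 * t : ℤ) := by
    rw [Tmap, ← pow_two, ← pow_mul]
    exact_mod_cast rfl
  rw [hT, Rmap_zpow, ← zpow_natCast Umap, Umap_zpow, kleinElt_mul, kleinSign_even (by simp)]
  simp

lemma Rmap_pow_odd (k : ℕ) : Rmap ^ (2 * k + 1) = kleinElt (2 * k + 1) 0 := by
  rw [← zpow_natCast, Rmap_zpow]
  push_cast
  rfl

lemma Smap_pow_odd (k : ℕ) : Smap ^ (2 * k + 1) = kleinElt (2 * k + 1) 1 := by
  have hS : Smap ^ 2 = Tmap := by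
    rw [Smap_eq, Tmap_eq, pow_two, kleinElt_mul, kleinSign_odd odd_one]
    norm_num
  have hT := Tmap_pow_mul_Umap_pow k 0
  rw [pow_zero, mul_one] at hT
  rw [pow_succ, pow_mul, hS, hT, Smap_eq, kleinElt_mul, kleinSign_even (by simp)]
  simp

lemma mem_kleinGroup_iff_s3 {g : Equiv.Perm (ℝ × ℝ)} :
    g ∈ kleinGroup ↔ ∃ n m : ℤ, g = kleinElt n m := by
  constructor
  · intro hg
    induction hg using Subgroup.closure_induction with
    | mem x hx =>
      rcases hx with rfl | rfl
      · exact ⟨_, _, Umap_eq⟩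
      · exact ⟨_, _, Rmap_eq⟩
    | one => exact ⟨_, _, kleinElt_zero.symm⟩
    | mul x y _ _ hx hy =>
      obtain ⟨n, m, rfl⟩ := hx
      obtain ⟨n', m', rfl⟩ := hy
      exact ⟨_, _, kleinElt_mul ..⟩
    | inv x _ hx =>
      obtain ⟨n, m, rfl⟩ := hx
      exact ⟨_, _, kleinElt_inv ..⟩
  · rintro ⟨n, m, rfl⟩
    have h : kleinElt n m = Umap ^ m * Rmap ^ n := by
      rw [Umap_zpow, Rmap_zpow, kleinElt_mul]
      simp
    rw [h]
    exact mul_mem (zpow_mem (Subgroup.subset_closure (by simp)) _)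
      (zpow_mem (Subgroup.subset_closure (by simp)) _)

lemma mem_kleinNormalForms_iff {h : Equiv.Perm (ℝ × ℝ)} :
    h ∈ kleinNormalForms ↔
      ∃ n m : ℤ, 0 ≤ n ∧ 0 ≤ m ∧ (Odd n → m ≤ 1) ∧ h = kleinElt n m := by
  simp only [kleinNormalForms, Set.mem_union, Set.mem_ofPred_eq, Tmap_pow_mul_Umap_pow,
    Rmap_pow_odd, Smap_pow_odd]
  constructor
  · rintro ((⟨t, u, rfl⟩ | ⟨k, rfl⟩) | ⟨k, rfl⟩)
    · exact ⟨_, _, by positivity, by positivity,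
        fun ho => absurd ho (by simp), rfl⟩
    · exact ⟨_, _, by positivity, le_rfl, fun _ => zero_le_one, rfl⟩
    · exact ⟨_, _, by positivity, zero_le_one, fun _ => le_rfl, rfl⟩
  · rintro ⟨n, m, hn, hm, hodd, rfl⟩
    lift n to ℕ using hn
    lift m to ℕ using hm
    rcases Nat.even_or_odd' n with ⟨k, rfl | rfl⟩
    · exact .inl (.inl ⟨k, m, by push_cast; rfl⟩)
    · have hm1 : (m : ℤ) ≤ 1 := hodd (by simp)
      obtain rfl | rfl : m = 0 ∨ m = 1 := by omega
      · exact .inl (.inr ⟨k, by push_cast; rfl⟩)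
      · exact .inr ⟨k, by push_cast; rfl⟩

/-- Conjugacy up to inversion, in the coordinates of `kleinElt`. -/
lemma kleinElt_conj_or_inv_iff (n m p q : ℤ) :
    (∃ a ∈ kleinGroup, a * kleinElt n m * a⁻¹ = kleinElt p q ∨
      a * (kleinElt n m)⁻¹ * a⁻¹ = kleinElt p q) ↔
    (n = p ∨ n = -p) ∧ (Even n ∧ (m = q ∨ m = -q) ∨ Odd n ∧ Even (m - q)) := by
  constructor
  · rintro ⟨x, hx, h⟩
    obtain ⟨a, b, rfl⟩ := mem_kleinGroup_iff_s3.1 hx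
    simp only [kleinElt_inv n m, kleinElt_conj, kleinElt_inj, kleinSign_neg] at h
    refine ⟨by omega, ?_⟩
    rcases Int.even_or_odd n with hn | hn <;> rcases Int.even_or_odd a with ha | ha <;>
      simp only [kleinSign_even, kleinSign_odd, hn, ha] at h <;>
      [left; left; right; right] <;> refine ⟨hn, ?_⟩ <;>
      (try rw [Int.even_iff]) <;> omega
  · rintro ⟨hp, ⟨hn, hq⟩ | ⟨hn, c, hc⟩⟩
    · have key : ∀ a : ℤ, kleinElt a 0 ∈ kleinGroup := fun a => mem_kleinGroup_iff_s3.2 ⟨_, _, rfl⟩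
      have h0 := kleinSign_even Even.zero
      have h1 := kleinSign_odd odd_one
      have hn' := kleinSign_even hn
      rcases hp with hp | hp <;> rcases hq with hq | hq
      · refine ⟨_, key 0, .inl ?_⟩
        simp [kleinElt_conj, *]
      · refine ⟨_, key 1, .inl ?_⟩
        rw [kleinElt_conj, kleinElt_inj, h1]
        omega
      · refine ⟨_, key 1, .inr ?_⟩
        rw [kleinElt_inv n, kleinElt_conj, kleinElt_inj, h1, hn']
        omega
      · refine ⟨_, key 0, .inr ?_⟩
        rw [kleinElt_inv n, kleinElt_conj, kleinElt_inj, h0, hn']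
        omega
    · have h0 := kleinSign_even Even.zero
      have hn' := kleinSign_odd hn
      refine ⟨kleinElt 0 (-c), mem_kleinGroup_iff_s3.2 ⟨_, _, rfl⟩, ?_⟩
      rcases hp with hp | hp
      · left
        rw [kleinElt_conj, kleinElt_inj, h0, hn']
        omega
      · right
        rw [kleinElt_inv n, kleinElt_conj, kleinElt_inj, kleinSign_neg, h0, hn']
        omega

/-- Classification of closed curves on the Klein bottle: every element `g` of
`Γ = ⟨U, R⟩` is conjugate in `Γ` to exactly one normal form or its inverse. -/
theorem kleinGroup_normal_form (g : Equiv.Perm (ℝ × ℝ)) (hg : g ∈ kleinGroup) :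
    ∃! h : Equiv.Perm (ℝ × ℝ), h ∈ kleinNormalForms ∧
      ∃ a ∈ kleinGroup, a * h * a⁻¹ = g ∨ a * h⁻¹ * a⁻¹ = g := by
  obtain ⟨p, q, rfl⟩ := mem_kleinGroup_iff_s3.1 hg
  have existence : ∃ n m : ℤ, 0 ≤ n ∧ 0 ≤ m ∧ (Odd n → m ≤ 1) ∧
      (n = p ∨ n = -p) ∧ (Even n ∧ (m = q ∨ m = -q) ∨ Odd n ∧ Even (m - q)) := by
    simp only [Int.even_iff, Int.odd_iff]
    rcases Int.emod_two_eq_zero_or_one p with hp | hp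
    · exact ⟨p.natAbs, q.natAbs, by omega⟩
    · exact ⟨p.natAbs, q % 2, by omega⟩
  obtain ⟨n, m, hn, hm, hodd, hconj⟩ := existence
  refine ⟨kleinElt n m, ⟨mem_kleinNormalForms_iff.2 ⟨n, m, hn, hm, hodd, rfl⟩,
    (kleinElt_conj_or_inv_iff n m p q).2 hconj⟩, ?_⟩
  rintro h ⟨hh, hconj'⟩
  obtain ⟨n', m', hn', hm', hodd', rfl⟩ := mem_kleinNormalForms_iff.1 hh
  rw [kleinElt_conj_or_inv_iff] at hconj'
  rw [kleinElt_inj]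
  simp only [Int.even_iff, Int.odd_iff] at *
  omega
end

section
/- Let X be a topological space, let x ∈ X be a point admitting a compact neighborhood, let n ∈ ℕ, and let F : X × E → ℝ be a continuous function (E = EuclideanSpace ℝ (Fin n)) such that for every y ∈ X the function v ↦ F(y,v) is a directed norm. Then for every real μ > 1 there exists a neighborhood U of x in X such that F(y', v) ≤ μ * F(y, v) for all y, y' ∈ U and all v ∈ E. -/
open Topology

/-- A directed norm on `EuclideanSpace ℝ (Fin n)`: subadditive, positively
homogeneous and positive definite, but not necessarily symmetric. -/
def IsDirectedNorm {n : ℕ} (N : EuclideanSpace ℝ (Fin n) → ℝ) : Prop :=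
  (∀ v w, N (v + w) ≤ N v + N w) ∧
    (∀ (c : ℝ) v, 0 ≤ c → N (c • v) = c * N v) ∧
    (∀ v, v ≠ 0 → 0 < N v)

/-- Continuity of Finsler metrics (first part): if `F` is a continuous family of
directed norms over `X` and `x` has a compact neighborhood, then for every
`μ > 1` there is a neighborhood `U` of `x` such that `F (y', ·) ≤ μ * F (y, ·)`
for all `y, y' ∈ U`. -/
theorem finsler_continuity_norm {X : Type*} [TopologicalSpace X] (x : X)
    (hx : ∃ K ∈ 𝓝 x, IsCompact K) (n : ℕ)
    (F : X × EuclideanSpace ℝ (Fin n) → ℝ) (hF : Continuous F)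
    (hnorm : ∀ y : X, IsDirectedNorm fun v => F (y, v))
    (μ : ℝ) (hμ : 1 < μ) :
    ∃ U ∈ 𝓝 x, ∀ y ∈ U, ∀ y' ∈ U, ∀ v : EuclideanSpace ℝ (Fin n),
      F (y', v) ≤ μ * F (y, v) := by
  have h_sphere : ∀ᶠ p : X × X in 𝓝 (x, x),
      ∀ v ∈ Metric.sphere (0 : EuclideanSpace ℝ (Fin n)) 1, F (p.2, v) < μ * F (p.1, v) := by
    refine (isCompact_sphere _ _).eventually_forall_of_forall_eventually fun v hv => ?_
    have h_pos : 0 < F (x, v) := (hnorm x).2.2 v (ne_zero_of_mem_unit_sphere ⟨v, hv⟩)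
    exact ContinuousAt.eventually_lt
      (f := fun q : (X × X) × EuclideanSpace ℝ (Fin n) => F (q.1.2, q.2))
      (g := fun q => μ * F (q.1.1, q.2))
      (by fun_prop) (by fun_prop) (lt_mul_of_one_lt_left h_pos hμ)
  rw [nhds_prod_eq, Filter.eventually_prod_self_iff'] at h_sphere
  obtain ⟨U, hU, h_lt⟩ := h_sphere
  refine ⟨U, hU, fun y hy y' hy' v => ?_⟩
  have h_scale (z : X) : F (z, v) = ‖v‖ * F (z, ‖v‖⁻¹ • v) := by
    rcases eq_or_ne v 0 with rfl | hv
    · simpa using (hnorm z).2.1 0 0 le_rfl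
    · rw [← (hnorm z).2.1 _ _ (norm_nonneg v), smul_inv_smul₀ (norm_ne_zero_iff.2 hv)]
  rcases eq_or_ne v 0 with rfl | hv
  · rw [h_scale y, h_scale y']
    simp
  · rw [h_scale y, h_scale y', mul_left_comm]
    refine mul_le_mul_of_nonneg_left (h_lt y hy y' hy' _ ?_).le (norm_nonneg v)
    simpa using norm_smul_inv_norm (𝕜 := ℝ) hv
end

section
/- Let X be a topological space, let x ∈ X, let n ∈ ℕ, and let F : X × E → ℝ be a continuous function (E = EuclideanSpace ℝ (Fin n)) such that for every y ∈ X the function v ↦ F(y,v) is a directed seminorm. Then for every real ε > 0 there exists a neighborhood U of x in X such that F(y', v) ≤ F(y, v) + ε * ‖v‖ for all y, y' ∈ U and all v ∈ E, where ‖v‖ is the Euclidean norm. -/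
open Topology

/-- A directed seminorm on `EuclideanSpace ℝ (Fin n)`: subadditive, positively
homogeneous and nonnegative, but not necessarily symmetric. -/
def IsDirectedSeminorm {n : ℕ} (N : EuclideanSpace ℝ (Fin n) → ℝ) : Prop :=
  (∀ v w, N (v + w) ≤ N v + N w) ∧
    (∀ (c : ℝ) v, 0 ≤ c → N (c • v) = c * N v) ∧
    (∀ v, 0 ≤ N v)

/-- Continuity of Finsler metrics (second part): if `F` is a continuous family
of directed seminorms over `X`, then for every `ε > 0` there is a neighborhood
`U` of `x` such that `F (y', v) ≤ F (y, v) + ε * ‖v‖` for all `y, y' ∈ U`. -/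
theorem finsler_continuity_seminorm {X : Type*} [TopologicalSpace X] (x : X)
    (n : ℕ) (F : X × EuclideanSpace ℝ (Fin n) → ℝ) (hF : Continuous F)
    (hnorm : ∀ y : X, IsDirectedSeminorm fun v => F (y, v))
    (ε : ℝ) (hε : 0 < ε) :
    ∃ U ∈ 𝓝 x, ∀ y ∈ U, ∀ y' ∈ U, ∀ v : EuclideanSpace ℝ (Fin n),
      F (y', v) ≤ F (y, v) + ε * ‖v‖ := by
  have hU : ∀ᶠ y in 𝓝 x, ∀ v ∈ Metric.sphere (0 : EuclideanSpace ℝ (Fin n)) 1,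
      |F (y, v) - F (x, v)| < ε / 2 := by
    refine (isCompact_sphere (0 : EuclideanSpace ℝ (Fin n)) 1).eventually_forall_of_forall_eventually
      fun v _ => ?_
    have hcont : Continuous fun z : X × EuclideanSpace ℝ (Fin n) =>
        |F (z.1, z.2) - F (x, z.2)| := by fun_prop
    exact hcont.continuousAt.eventually_lt continuousAt_const (by simpa using hε)
  refine ⟨_, hU, fun y hy y' hy' v => ?_⟩
  rcases eq_or_ne v 0 with rfl | hv
  · have hzero : ∀ z, F (z, 0) = 0 := fun z => by
      simpa using (hnorm z).2.1 0 0 le_rfl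
    simp [hzero]
  · have hu : ‖v‖⁻¹ • v ∈ Metric.sphere (0 : EuclideanSpace ℝ (Fin n)) 1 := by
      simp [norm_smul, hv]
    have hscale : ∀ z, F (z, v) = ‖v‖ * F (z, ‖v‖⁻¹ • v) := fun z => by
      simpa [smul_smul, hv] using (hnorm z).2.1 ‖v‖ (‖v‖⁻¹ • v) (norm_nonneg v)
    have hle : F (y', ‖v‖⁻¹ • v) ≤ F (y, ‖v‖⁻¹ • v) + ε := by
      linarith [(abs_lt.mp (hy _ hu)).1, (abs_lt.mp (hy' _ hu)).2]
    rw [hscale y, hscale y']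
    nlinarith [mul_le_mul_of_nonneg_left hle (norm_nonneg v)]
end

section
/- Let k ∈ ℕ and let u : Fin k → ℝ × ℝ. Let Z be the Minkowski sum over i ∈ Fin k of the segments [0, u i] ⊆ ℝ × ℝ (sum taken with pointwise set addition). Then the Lebesgue measure of Z equals ∑_{i < j} |(u i).1 * (u j).2 − (u i).2 * (u j).1|, the sum taken over all pairs i < j in Fin k. -/
open Pointwise MeasureTheory

theorem isCompact_segment_zero (v : ℝ × ℝ) : IsCompact (segment ℝ 0 v) := by
  rw [segment_eq_image_lineMap]
  exact isCompact_Icc.image AffineMap.lineMap_continuous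

theorem isCompact_sum_segment {ι : Type*} (s : Finset ι) (u : ι → ℝ × ℝ) :
    IsCompact (∑ i ∈ s, segment ℝ (0 : ℝ × ℝ) (u i)) := by
  classical
  induction s using Finset.induction_on with
  | empty => simp
  | insert i s hi ih =>
    rw [Finset.sum_insert hi]
    exact (isCompact_segment_zero _).add ih

theorem convex_sum_segment {ι : Type*} (s : Finset ι) (u : ι → ℝ × ℝ) :
    Convex ℝ (∑ i ∈ s, segment ℝ (0 : ℝ × ℝ) (u i)) :=
  convex_sum _ fun i _ => convex_segment 0 (u i)

theorem mem_add_segment_horizontal {K : Set (ℝ × ℝ)} {a : ℝ} (ha : 0 ≤ a) {x y : ℝ} :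
    (x, y) ∈ K + segment ℝ (0 : ℝ × ℝ) (a, 0) ↔ x ∈ (fun x => (x, y)) ⁻¹' K + Set.Icc 0 a := by
  rw [← segment_eq_Icc ha]
  simp only [Set.mem_add, segment_eq_image, Set.mem_image, Set.mem_preimage]
  constructor
  · rintro ⟨⟨p, q⟩, hp, _, ⟨t, ht, rfl⟩, h⟩
    simp only [Prod.smul_mk, smul_zero, smul_eq_mul, mul_zero, zero_add, Prod.mk_add_mk, add_zero,
      Prod.mk.injEq] at h
    obtain ⟨rfl, rfl⟩ := h
    exact ⟨p, hp, _, ⟨t, ht, rfl⟩, by simp⟩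
  · rintro ⟨p, hp, _, ⟨t, ht, rfl⟩, rfl⟩
    exact ⟨(p, y), hp, _, ⟨t, ht, rfl⟩, by simp⟩

/-- Sweeping a nonempty compact convex set of reals along `[0, a]` adds `a` to its length. -/
theorem volume_add_Icc_zero {s : Set ℝ} (hs : IsCompact s) (hc : Convex ℝ s) (hne : s.Nonempty)
    {a : ℝ} (ha : 0 ≤ a) : volume (s + Set.Icc 0 a) = volume s + ENNReal.ofReal a := by
  have h := eq_Icc_of_connected_compact ⟨hne, hc.isPreconnected⟩ hs
  have hle : sInf s ≤ sSup s := by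
    rw [h] at hne
    exact Set.nonempty_Icc.mp hne
  rw [h, Set.Icc_add_Icc hle ha, Real.volume_Icc, Real.volume_Icc,
    ← ENNReal.ofReal_add (by linarith) ha]
  ring_nf

theorem volume_add_segment_horizontal {K : Set (ℝ × ℝ)} (hK : IsCompact K) (hc : Convex ℝ K)
    {a : ℝ} (ha : 0 ≤ a) :
    volume (K + segment ℝ (0 : ℝ × ℝ) (a, 0)) =
      volume K + ENNReal.ofReal a * volume (Prod.snd '' K) := by
  have hproj : MeasurableSet (Prod.snd '' K) := (hK.image continuous_snd).measurableSet
  have hslice (y : ℝ) : volume ((fun x => (x, y)) ⁻¹' (K + segment ℝ (0 : ℝ × ℝ) (a, 0))) =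
      volume ((fun x => (x, y)) ⁻¹' K) +
        (Prod.snd '' K).indicator (fun _ => ENNReal.ofReal a) y := by
    have hset : (fun x => (x, y)) ⁻¹' (K + segment ℝ (0 : ℝ × ℝ) (a, 0)) =
        (fun x => (x, y)) ⁻¹' K + Set.Icc 0 a := by
      ext x
      exact mem_add_segment_horizontal ha
    rw [hset]
    by_cases hy : y ∈ Prod.snd '' K
    · rw [Set.indicator_of_mem hy]
      refine volume_add_Icc_zero ?_ ?_ ?_ ha
      · refine (hK.image continuous_fst).of_isClosed_subset
          (hK.isClosed.preimage (by fun_prop)) fun x hx => ⟨_, hx, rfl⟩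
      · intro p hp q hq s t hs ht hst
        have := hc hp hq hs ht hst
        simpa [← add_mul, hst] using this
      · obtain ⟨⟨x, _⟩, hx, rfl⟩ := hy
        exact ⟨x, hx⟩
    · have hempty : (fun x => (x, y)) ⁻¹' K = ∅ :=
        Set.eq_empty_of_forall_notMem fun x hx => hy ⟨_, hx, rfl⟩
      simp [hempty, Set.indicator_of_notMem hy]
  have hsum : MeasurableSet (K + segment ℝ (0 : ℝ × ℝ) (a, 0)) :=
    (hK.add (isCompact_segment_zero _)).measurableSet
  rw [Measure.volume_eq_prod, Measure.prod_apply_symm hsum, Measure.prod_apply_symm hK.measurableSet]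
  simp_rw [hslice]
  rw [lintegral_add_right _ (measurable_const.indicator hproj), lintegral_indicator_const hproj]

/-- The similarity of the plane sending `v` to the horizontal vector `(|v|², 0)`. -/
def alignHorizontal (v : ℝ × ℝ) : ℝ × ℝ →ₗ[ℝ] ℝ × ℝ where
  toFun p := (v.1 * p.1 + v.2 * p.2, v.1 * p.2 - v.2 * p.1)
  map_add' p q := by ext <;> simp <;> ring
  map_smul' c p := by ext <;> simp <;> ring

theorem det_alignHorizontal (v : ℝ × ℝ) :
    LinearMap.det (alignHorizontal v) = v.1 ^ 2 + v.2 ^ 2 := by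
  rw [← LinearMap.det_toMatrix (Module.Basis.finTwoProd ℝ), Matrix.det_fin_two]
  simp [LinearMap.toMatrix_apply, alignHorizontal]
  ring

theorem volume_add_segment {K : Set (ℝ × ℝ)} (hK : IsCompact K) (hc : Convex ℝ K) (v : ℝ × ℝ) :
    volume (K + segment ℝ 0 v) =
      volume K + volume ((fun p : ℝ × ℝ => v.1 * p.2 - v.2 * p.1) '' K) := by
  by_cases hv : v = 0
  · subst hv
    have hnull : volume ((fun _ : ℝ × ℝ => (0 : ℝ)) '' K) = 0 :=
      measure_mono_null (Set.image_subset_iff.mpr fun _ _ => Set.mem_singleton 0)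
        (measure_singleton (0 : ℝ))
    simp [hnull]
  have hpos : 0 < v.1 ^ 2 + v.2 ^ 2 := by
    by_contra! h
    exact hv (Prod.ext (by simp; nlinarith [sq_nonneg v.1, sq_nonneg v.2])
      (by simp; nlinarith [sq_nonneg v.1, sq_nonneg v.2]))
  have hcont : Continuous (alignHorizontal v) := LinearMap.continuous_of_finiteDimensional _
  have hvol (s : Set (ℝ × ℝ)) : volume (alignHorizontal v '' s) =
      ENNReal.ofReal (v.1 ^ 2 + v.2 ^ 2) * volume s := by
    rw [Measure.addHaar_image_linearMap, det_alignHorizontal, abs_of_pos hpos]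
  have hseg : alignHorizontal v '' segment ℝ 0 v = segment ℝ 0 (v.1 ^ 2 + v.2 ^ 2, 0) := by
    have := image_segment ℝ (alignHorizontal v).toAffineMap 0 v
    simp only [LinearMap.coe_toAffineMap, map_zero] at this
    rw [this]
    congr 1
    ext <;> simp [alignHorizontal] <;> ring
  have hmain := volume_add_segment_horizontal (hK.image hcont)
    (hc.linear_image (alignHorizontal v)) hpos.le
  rw [← hseg, ← Set.image_add, hvol, hvol, ← mul_add, Set.image_image] at hmain
  exact (ENNReal.mul_right_inj (by simpa using hpos) ENNReal.ofReal_ne_top).mp hmain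

theorem image_sum_segment_eq_Icc {ι : Type*} (s : Finset ι) (u : ι → ℝ × ℝ)
    (f : ℝ × ℝ →ₗ[ℝ] ℝ) :
    ∃ p q : ℝ, p ≤ q ∧ f '' (∑ i ∈ s, segment ℝ 0 (u i)) = Set.Icc p q ∧
      q - p = ∑ i ∈ s, |f (u i)| := by
  classical
  induction s using Finset.induction_on with
  | empty => exact ⟨0, 0, le_rfl, by simp [← Set.singleton_zero], by simp⟩
  | insert i s hi ih =>
    obtain ⟨p, q, hpq, himage, hlen⟩ := ih
    refine ⟨min 0 (f (u i)) + p, max 0 (f (u i)) + q,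
      add_le_add min_le_max hpq, ?_, ?_⟩
    · have hseg := image_segment ℝ f.toAffineMap 0 (u i)
      simp only [LinearMap.coe_toAffineMap, map_zero] at hseg
      rw [Finset.sum_insert hi, Set.image_add, himage, hseg, segment_eq_uIcc, Set.uIcc,
        Set.Icc_add_Icc min_le_max hpq]
    · have := max_sub_min_eq_abs (0 : ℝ) (f (u i))
      rw [sub_zero] at this
      rw [Finset.sum_insert hi, ← hlen, ← this]
      ring

theorem volume_image_sum_segment {ι : Type*} (s : Finset ι) (u : ι → ℝ × ℝ)
    (f : ℝ × ℝ →ₗ[ℝ] ℝ) :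
    volume (f '' (∑ i ∈ s, segment ℝ 0 (u i))) = ENNReal.ofReal (∑ i ∈ s, |f (u i)|) := by
  obtain ⟨p, q, -, himage, hlen⟩ := image_sum_segment_eq_Icc s u f
  rw [himage, Real.volume_Icc, hlen]

/-- Area of a zonogon: the Lebesgue measure of a Minkowski sum of segments
`[0, u i]` in the plane equals the sum over pairs `i < j` of the areas
`|det(u i, u j)|` of the generating parallelograms. -/
theorem zonogon_area (k : ℕ) (u : Fin k → ℝ × ℝ) :
    volume (∑ i : Fin k, segment ℝ (0 : ℝ × ℝ) (u i)) =
      ENNReal.ofReal (∑ i : Fin k, ∑ j : Fin k,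
        if i < j then |(u i).1 * (u j).2 - (u i).2 * (u j).1| else 0) := by
  induction k with
  | zero => simp [← Set.singleton_zero]
  | succ k ih =>
    have hwidth := volume_image_sum_segment Finset.univ (fun i : Fin k => u i.castSucc)
      (LinearMap.snd ℝ ℝ ℝ ∘ₗ alignHorizontal (u (Fin.last k)))
    have hlast (i : Fin k) : ¬ Fin.last k < i.castSucc := (Fin.castSucc_lt_last i).not_gt
    rw [Fin.sum_univ_castSucc,
      volume_add_segment (isCompact_sum_segment _ _) (convex_sum_segment _ _), ih]
    refine (congrArg _ hwidth).trans ?_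
    rw [← ENNReal.ofReal_add
      (Finset.sum_nonneg fun i _ => Finset.sum_nonneg fun j _ => by split_ifs <;> positivity)
      (Finset.sum_nonneg fun i _ => abs_nonneg _)]
    congr 1
    simp only [Fin.sum_univ_castSucc, Fin.castSucc_lt_castSucc_iff, Fin.castSucc_lt_last, if_true,
      hlast, lt_irrefl, if_false, Finset.sum_const_zero, add_zero, Finset.sum_add_distrib]
    congr 1
    refine Finset.sum_congr rfl fun i _ => ?_
    rw [← abs_neg]
    congr 1
    simp [alignHorizontal]
    ring
end

section
/- Let n ≥ 1 and let τ : ZMod (2n) → ZMod (2n) satisfy τ(τ(i)) = i and τ(i) ≠ i for all i. Say that the chords through i and through j cross if the four points i, τ(i), j,τ(j) are pairwise distinct and exactly one of the two conditions ((j − i).val < (τ(i) − i).val) and ((τ(j) − i).val < (τ(i) − i).val) holds. Suppose that for every i ∈ ZMod (2n) with τ(i) ≠ i + 1, the chords through i and through i + 1 cross. Then τ(i) = i + n for every i ∈ ZMod (2n). -/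
/-- The chords through `i` and through `j` (of the chord pairing `τ`) cross:
the four endpoints `i, τ i, j, τ j` are pairwise distinct and the two pairs
interlace along the circle `ZMod m`. -/
def ChordsCross {m : ℕ} (τ : ZMod m → ZMod m) (i j : ZMod m) : Prop :=
  List.Pairwise (· ≠ ·) [i, τ i, j, τ j] ∧
    Xor' ((j - i).val < (τ i - i).val) ((τ j - i).val < (τ i - i).val)

/-- If consecutive chords cross, the arc length from an endpoint to its partner does not decrease
when passing to the next endpoint. -/
theorem arcLength_le_succ {m : ℕ} (hm : 1 < m) {τ : ZMod m → ZMod m} (hfix : ∀ i, τ i ≠ i)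
    (hcross : ∀ i, τ i ≠ i + 1 → ChordsCross τ i (i + 1)) (i : ZMod m) :
    (τ i - i).val ≤ (τ (i + 1) - (i + 1)).val := by
  have : Fact (1 < m) := ⟨hm⟩
  have : NeZero m := ⟨by omega⟩
  have val_pos {x : ZMod m} (hx : x ≠ 0) : 0 < x.val :=
    Nat.pos_of_ne_zero fun h => hx ((ZMod.val_eq_zero x).1 h)
  by_cases h : τ i = i + 1
  · rw [h, add_sub_cancel_left, ZMod.val_one]
    exact val_pos (sub_ne_zero.2 (hfix _))
  obtain ⟨hne, hx⟩ := hcross i h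
  simp only [List.pairwise_cons, List.mem_cons, List.not_mem_nil, or_false, forall_eq_or_imp,
    forall_eq] at hne
  have hpos := val_pos (sub_ne_zero.2 (hfix i))
  have hone : (τ i - i).val ≠ 1 := fun h1 => h <| by
    rw [← ZMod.val_one m] at h1
    rw [← ZMod.val_injective m h1, add_sub_cancel]
  have hdist : (τ i - i).val ≠ (τ (i + 1) - i).val := fun h1 =>
    hne.2.1.2 (sub_left_injective (ZMod.val_injective m h1))
  have hlt : (i + 1 - i).val < (τ i - i).val := by
    rw [add_sub_cancel_left, ZMod.val_one]; omega
  have hnlt : ¬ (τ (i + 1) - i).val < (τ i - i).val := by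
    rcases hx with ⟨-, hx⟩ | ⟨-, hx⟩
    · exact hx
    · exact absurd hlt hx
  rw [← sub_sub, ZMod.val_sub (a := τ (i + 1) - i) (b := 1) (by rw [ZMod.val_one]; omega),
    ZMod.val_one]
  omega

/-- A function on `ZMod m` that never decreases from one element to the next is constant. -/
theorem ZMod.eq_of_le_succ {m : ℕ} [NeZero m] {α : Type*} [PartialOrder α] {f : ZMod m → α}
    (hf : ∀ i, f i ≤ f (i + 1)) (i j : ZMod m) : f i = f j := by
  have le_add (i : ZMod m) (k : ℕ) : f i ≤ f (i + k) := by
    induction k with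
    | zero => simp
    | succ k ih => simpa [add_assoc] using ih.trans (hf _)
  have le (i j : ZMod m) : f i ≤ f j := by
    simpa using le_add i (j - i).val
  exact (le i j).antisymm (le j i)

/-- Completability of pseudoline arrangements, combinatorial core: if `τ` is a
fixed-point-free involution of `ZMod (2n)` such that every pair of chords with
consecutive endpoints crosses, then every endpoint is paired with its
antipode. -/
theorem chord_pairing_antipodal (n : ℕ) (hn : 1 ≤ n)
    (τ : ZMod (2 * n) → ZMod (2 * n))
    (hinv : ∀ i, τ (τ i) = i) (hfix : ∀ i, τ i ≠ i)
    (hcross : ∀ i : ZMod (2 * n), τ i ≠ i + 1 → ChordsCross τ i (i + 1)) :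
    ∀ i : ZMod (2 * n), τ i = i + (n : ZMod (2 * n)) := by
  have : NeZero (2 * n) := ⟨by omega⟩
  intro i
  have hconst := ZMod.eq_of_le_succ (f := fun i => (τ i - i).val)
    (arcLength_le_succ (by omega) hfix hcross) i (τ i)
  have : NeZero (τ i - i) := ⟨sub_ne_zero.2 (hfix i)⟩
  have hlt := ZMod.val_lt (τ i - i)
  simp only [hinv] at hconst
  rw [← neg_sub (τ i) i, ZMod.val_neg_of_ne_zero] at hconst
  have hval : (τ i - i).val = n := by omega
  have hcast : τ i - i = (n : ZMod (2 * n)) :=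
    (ZMod.natCast_zmod_val (τ i - i)).symm.trans (congrArg Nat.cast hval)
  rw [← sub_eq_iff_eq_add', hcast]
end

section
/- Let n ≥ 1, let τ : ZMod (2n) → ZMod (2n) satisfy τ(τ(e)) = e and τ(e) ≠ e for all e, and for x, y ∈ ZMod (2n) let arc(x,y) := {e : (e − x).val < (y − x).val} and sep(x,y) := the cardinality of {e : (e ∈ arc(x,y)) ≠ (τ(e) ∈ arc(x,y))}. Let a, a', b, b' ∈ ZMod (2n) satisfy (a' − a).val ≥ 1, (b − a').val ≥ 1, (b' − b).val ≥ 1, (a − b').val ≥ 1, and (a' − a).val + (b − a').val + (b' − b).val + (a − b').val = 2n. Then sep(a,b) + sep(a',b') = sep(a,b') + sep(a',b) + 4 * (the cardinality of {e : e ∈ arc(a,a') and τ(e) ∈ arc(b,b')}). -/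
/-- The set of endpoints passed when travelling counterclockwise from cut `x`
to cut `y` along the circle `ZMod m`. -/
def arcSet {m : ℕ} (x y : ZMod m) : Set (ZMod m) :=
  {e | (e - x).val < (y - x).val}

/-- Twice the number of chords of the pairing `τ` separating the cuts `x` and
`y`: each separating chord has exactly one endpoint in `arcSet x y`, and is
counted once for each of its endpoints. -/
noncomputable def sepCount {m : ℕ} (τ : ZMod m → ZMod m) (x y : ZMod m) : ℕ :=
  Nat.card {e : ZMod m | (e ∈ arcSet x y) ≠ (τ e ∈ arcSet x y)}

theorem ZMod.val_sub_eq_ite {m : ℕ} [NeZero m] (u v : ZMod m) :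
    (u - v).val = if v.val ≤ u.val then u.val - v.val else u.val + m - v.val := by
  split_ifs with h
  · exact ZMod.val_sub h
  · have hv := ZMod.val_lt v
    have hlt : (v - u).val < m := ZMod.val_lt _
    have hvu : (v - u).val = v.val - u.val := ZMod.val_sub (by omega)
    have hne : v - u ≠ 0 := by
      intro h0
      rw [h0, ZMod.val_zero] at hvu
      omega
    have : NeZero (v - u) := ⟨hne⟩
    rw [← neg_sub v u, ZMod.val_neg_of_ne_zero, hvu]
    omega

/-- The position of `u` counted from `x` in terms of positions counted from `a`. -/
theorem ZMod.val_sub_eq_ite_of_base {m : ℕ} [NeZero m] (a u x : ZMod m) :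
    (u - x).val = if (x - a).val ≤ (u - a).val then (u - a).val - (x - a).val
      else (u - a).val + m - (x - a).val := by
  rw [← ZMod.val_sub_eq_ite, sub_sub_sub_cancel_right]

/-- Cuts in cyclic order, with the four arcs between consecutive cuts covering the circle once,
are linearly ordered when positions are counted from the first one. -/
theorem val_sub_lt_of_cyclic {m : ℕ} [NeZero m] {a a' b b' : ZMod m}
    (h1 : 1 ≤ (a' - a).val) (h2 : 1 ≤ (b - a').val)
    (h3 : 1 ≤ (b' - b).val) (h4 : 1 ≤ (a - b').val)
    (hsum : (a' - a).val + (b - a').val + (b' - b).val + (a - b').val = m) :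
    (a' - a).val < (b - a).val ∧ (b - a).val < (b' - a).val := by
  have := ZMod.val_lt (a' - a)
  have := ZMod.val_lt (b - a)
  have := ZMod.val_lt (b' - a)
  have e2 := ZMod.val_sub_eq_ite_of_base a b a'
  have e3 := ZMod.val_sub_eq_ite_of_base a b' b
  have e4 := ZMod.val_sub_eq_ite_of_base a a b'
  rw [sub_self, ZMod.val_zero] at e4
  split_ifs at e2 e3 e4 <;> omega

theorem mem_arcSet_iff_of_le {m : ℕ} [NeZero m] (a : ZMod m) {x y : ZMod m}
    (h : (x - a).val ≤ (y - a).val) (e : ZMod m) :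
    e ∈ arcSet x y ↔ (x - a).val ≤ (e - a).val ∧ (e - a).val < (y - a).val := by
  have := ZMod.val_lt (x - a)
  have := ZMod.val_lt (y - a)
  rw [arcSet, Set.mem_ofPred_eq, ZMod.val_sub_eq_ite_of_base a e x,
    ZMod.val_sub_eq_ite_of_base a y x, if_pos h]
  split_ifs <;> omega

open scoped Classical in
theorem Nat.card_setOf_eq_sum {α : Type*} [Fintype α] (p : α → Prop) :
    Nat.card {e | p e} = ∑ e, if p e then 1 else 0 := by
  rw [Finset.sum_boole, Nat.cast_id, Nat.card_eq_fintype_card]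
  exact Fintype.card_subtype p

/-- The funicular formula, combinatorial core: for a fixed-point-free
involution `τ` of `ZMod (2n)` pairing the wall endpoints, and cuts
`a, a', b, b'` in counterclockwise cyclic order,
`sep(a,b) + sep(a',b') - sep(a,b') - sep(a',b)` equals four times the number of
chords joining the arc from `a` to `a'` to the arc from `b` to `b'`. -/
theorem funicular_formula (n : ℕ) (hn : 1 ≤ n)
    (τ : ZMod (2 * n) → ZMod (2 * n))
    (hinv : ∀ e, τ (τ e) = e) (hfix : ∀ e, τ e ≠ e)
    (a a' b b' : ZMod (2 * n))
    (h1 : 1 ≤ (a' - a).val) (h2 : 1 ≤ (b - a').val)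
    (h3 : 1 ≤ (b' - b).val) (h4 : 1 ≤ (a - b').val)
    (hsum : (a' - a).val + (b - a').val + (b' - b).val + (a - b').val = 2 * n) :
    sepCount τ a b + sepCount τ a' b' =
      sepCount τ a b' + sepCount τ a' b +
        4 * Nat.card {e : ZMod (2 * n) | e ∈ arcSet a a' ∧ τ e ∈ arcSet b b'} := by
  classical
  have : NeZero (2 * n) := ⟨by omega⟩
  obtain ⟨hab, hbb⟩ := val_sub_lt_of_cyclic h1 h2 h3 h4 hsum
  have ha : (a - a).val = 0 := by rw [sub_self, ZMod.val_zero]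
  have swap : Nat.card {e | e ∈ arcSet a a' ∧ τ e ∈ arcSet b b'} =
      Nat.card {e | τ e ∈ arcSet a a' ∧ e ∈ arcSet b b'} :=
    Nat.card_congr <| (Function.Involutive.toPerm τ hinv).subtypeEquiv fun e => by
      change e ∈ arcSet a a' ∧ τ e ∈ arcSet b b' ↔ τ (τ e) ∈ arcSet a a' ∧ τ e ∈ arcSet b b'
      rw [hinv e]
  have split4 : 4 * Nat.card {e | e ∈ arcSet a a' ∧ τ e ∈ arcSet b b'} =
      2 * Nat.card {e | e ∈ arcSet a a' ∧ τ e ∈ arcSet b b'} +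
        2 * Nat.card {e | τ e ∈ arcSet a a' ∧ e ∈ arcSet b b'} := by
    rw [← swap]
    ring
  rw [split4]
  simp only [sepCount, Nat.card_setOf_eq_sum, Finset.mul_sum, ← Finset.sum_add_distrib]
  refine Finset.sum_congr rfl fun e _ => ?_
  simp only [ne_eq, eq_iff_iff, mem_arcSet_iff_of_le a (x := a) (y := b) (by omega),
    mem_arcSet_iff_of_le a (x := a') (y := b') (by omega),
    mem_arcSet_iff_of_le a (x := a) (y := b') (by omega),
    mem_arcSet_iff_of_le a (x := a') (y := b) (by omega),
    mem_arcSet_iff_of_le a (x := a) (y := a') (by omega),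
    mem_arcSet_iff_of_le a (x := b) (y := b') (by omega), ha]
  generalize (e - a).val = s
  generalize (τ e - a).val = t
  split_ifs <;> omega
end

section
/- Let f, g : ZMod 4 → ℤ both be eikonal, and define D(f,g) := ((f(1)−f(0)) + (f(2)−f(3))) * ((g(3)−g(0)) + (g(2)−g(1))) − ((f(3)−f(0)) + (f(2)−f(1))) * ((g(1)−g(0)) + (g(2)−g(3))). Then: (a) if f(0) = f(2) and f(1) = f(3), or g(0) = g(2) and g(1) = g(3), then D(f,g) = 0; (b) if f is regular with minimum at i and g is regular with minimum at j, then D(f,g) = 8 when j = i + 1, D(f,g) = −8 when j = i + 3, and D(f,g) = 0 when j = i or j = i + 2. -/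
/-- A 0-form on the vertices of a square cell (listed in cyclic order) is
eikonal if it changes by `±1` along each side. -/
def Eikonal (f : ZMod 4 → ℤ) : Prop :=
  ∀ k : ZMod 4, f (k + 1) - f k = 1 ∨ f (k + 1) - f k = -1

/-- An eikonal 0-form is regular with minimum at `i` if its values at
`i, i+1, i+2, i+3` are `a, a+1, a+2, a+1`. -/
def RegularWithMin (f : ZMod 4 → ℤ) (i : ZMod 4) : Prop :=
  f (i + 1) = f i + 1 ∧ f (i + 2) = f i + 2 ∧ f (i + 3) = f i + 1

/-- `D(f,g) = 4·(df ∧ dg)(Q)`, four times the discrete exterior product of the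
differentials of `f` and `g` evaluated on the oriented square `Q`. -/
def wedgeD (f g : ZMod 4 → ℤ) : ℤ :=
  ((f 1 - f 0) + (f 2 - f 3)) * ((g 3 - g 0) + (g 2 - g 1)) -
    ((f 3 - f 0) + (f 2 - f 1)) * ((g 1 - g 0) + (g 2 - g 3))

/-- Up to a factor, `wedgeD f g` is the determinant of the increments of `f` and `g` along the two
diagonals of the square, from whichever vertex the square is read. -/
theorem wedgeD_eq_diagonals (f g : ZMod 4 → ℤ) (i : ZMod 4) :
    wedgeD f g = 2 * ((f (i + 2) - f i) * (g (i + 3) - g (i + 1)) -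
      (f (i + 3) - f (i + 1)) * (g (i + 2) - g i)) := by
  have h : i = 0 ∨ i = 1 ∨ i = 2 ∨ i = 3 := by
    revert i
    decide
  have h₁₁ : (1 + 1 : ZMod 4) = 2 := rfl
  have h₁₂ : (1 + 2 : ZMod 4) = 3 := rfl
  have h₁₃ : (1 + 3 : ZMod 4) = 0 := rfl
  have h₂₁ : (2 + 1 : ZMod 4) = 3 := rfl
  have h₂₂ : (2 + 2 : ZMod 4) = 0 := rfl
  have h₂₃ : (2 + 3 : ZMod 4) = 1 := rfl
  have h₃₁ : (3 + 1 : ZMod 4) = 0 := rfl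
  have h₃₂ : (3 + 2 : ZMod 4) = 1 := rfl
  have h₃₃ : (3 + 3 : ZMod 4) = 2 := rfl
  unfold wedgeD
  rcases h with rfl | rfl | rfl | rfl <;>
    simp only [zero_add, h₁₁, h₁₂, h₁₃, h₂₁, h₂₂, h₂₃, h₃₁, h₃₂, h₃₃] <;> ring

/-- If `f` is regular with minimum at `i`, only the increment of `g` along the diagonal avoiding
`i` contributes to `wedgeD f g`. -/
theorem RegularWithMin.wedgeD_eq {f : ZMod 4 → ℤ} {i : ZMod 4} (hf : RegularWithMin f i)
    (g : ZMod 4 → ℤ) : wedgeD f g = 4 * (g (i + 3) - g (i + 1)) := by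
  obtain ⟨h₁, h₂, h₃⟩ := hf
  rw [wedgeD_eq_diagonals f g i, h₁, h₂, h₃]
  ring

/-- Exterior product of differentials of eikonal 0-forms on a square:
`D(f,g) = 0` if `f` or `g` is singular, and if `f`, `g` are regular with minima
at `i`, `j` then `D(f,g)` is `8`, `-8` or `0` according to whether `j = i+1`,
`j = i+3`, or `j ∈ {i, i+2}`. -/
theorem eikonal_wedge_values (f g : ZMod 4 → ℤ)
    (hf : Eikonal f) (hg : Eikonal g) :
    (((f 0 = f 2 ∧ f 1 = f 3) ∨ (g 0 = g 2 ∧ g 1 = g 3)) → wedgeD f g = 0) ∧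
    (∀ i j : ZMod 4, RegularWithMin f i → RegularWithMin g j →
      ((j = i + 1 → wedgeD f g = 8) ∧
       (j = i + 3 → wedgeD f g = -8) ∧
       ((j = i ∨ j = i + 2) → wedgeD f g = 0))) := by
  refine ⟨?_, fun i j hi hj => ?_⟩
  · rw [wedgeD_eq_diagonals f g 0]
    simp only [zero_add]
    rintro (⟨h₀, h₁⟩ | ⟨h₀, h₁⟩) <;> simp [h₀, h₁]
  · rw [hi.wedgeD_eq]
    obtain ⟨h₁, h₂, h₃⟩ := hj
    refine ⟨?_, ?_, ?_⟩
    · rintro rfl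
      have e₂ : i + 1 + 2 = i + 3 := by ring
      rw [e₂] at h₂
      lia
    · rintro rfl
      have e₂ : i + 3 + 2 = i + 1 := by
        rw [add_assoc]
        rfl
      rw [e₂] at h₂
      lia
    · rintro (rfl | rfl)
      · lia
      · have e₁ : i + 2 + 1 = i + 3 := by ring
        have e₃ : i + 2 + 3 = i + 1 := by
          rw [add_assoc]
          rfl
        rw [e₁] at h₁
        rw [e₃] at h₃
        lia
end

section
/- Let X be a type and let d : X → X → ℕ satisfy the triangle inequality d(a,c) ≤ d(a,b) + d(b,c) for all a, b, c ∈ X. Let x, x' ∈ X satisfy d(x,x') + d(x',x) = 1. Then for every y ∈ X, exactly one of the following two equalities holds: d(x,x') + d(x',y) = d(x,y), or d(x',x) + d(x,y) = d(x',y). -/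
/-- The alternative for fine graphs: if `d` is a directed (natural-valued)
distance satisfying the triangle inequality, and `x`, `x'` satisfy
`d x x' + d x' x = 1`, then for every `y` exactly one of the equalities
`d x x' + d x' y = d x y` and `d x' x + d x y = d x' y` holds. -/
theorem fine_graph_alternative {X : Type*} (d : X → X → ℕ)
    (htri : ∀ a b c : X, d a c ≤ d a b + d b c)
    (x x' : X) (hxx : d x x' + d x' x = 1) (y : X) :
    Xor' (d x x' + d x' y = d x y) (d x' x + d x y = d x' y) := by
  have h₁ := htri x x' y
  have h₂ := htri x' x y
  refine xor_def.mpr ?_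
  omega
end
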